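/- Let δ ≥ 0, b ∈ ℝ, φ(ρ) = ρ + δ ln ρ + b, and let L₀ be the operator L₀g = g'' + (1 + 1/(4ρ²) + 8δ ρ^{-1} cos²φ) g on ρ > 0. Then for every k ≥ 1, every integer n ≥ 0 and every integer i ≥ 0 there exist real constants a^{kin}_{k'i'n'}, b^{kin}_{k'i'n'}, c^{kin}_{k'i'n'}, d^{kin}_{k'i'n'} (indexed by k' ∈ {k+1, k+2}, i' ≤ i, n−2 ≤ n' ≤ n+2, with n' ≥ 0) such that for all ρ > 0: L₀( ρ^{-k} ln^i ρ · cos nφ ) = (1−n²) ρ^{-k} ln^i ρ · cos nφ + Σ_{k'=k+1}^{k+2} Σ_{i' ≤ i} Σ_{n'=n−2}^{n+2} ( a^{kin}_{k'i'n'} cos n'φ + b^{kin}_{k'i'n'} sin n'φ ) ρ^{-k'} ln^{i'} ρ, and L₀( ρ^{-k} ln^i ρ · sin nφ ) = (1−n²) ρ^{-k} ln^i ρ · sin nφ + Σ_{k'=k+1}^{k+2} Σ_{i' ≤ i} Σ_{n'=n−2}^{n+2} ( c^{kin}_{k'i'n'} cos n'φ + d^{kin}_{k'i'n'} sin n'φ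 ) ρ^{-k'} ln^{i'} ρ. -/

import Mathlib

open Real

/-- The linearization `L₀ = L'(a cos φ)` of the ODE operator at `a cos φ`:
`L₀g = g'' + (1 + 1/(4ρ²) + 8δρ^{-1}cos²φ)g`, with `φ(ρ) = ρ + δ log ρ + b`. -/
noncomputable def L0 (δ b : ℝ) (g : ℝ → ℝ) (ρ : ℝ) : ℝ :=
  deriv (deriv g) ρ
    + (1 + 1 / (4 * ρ ^ 2) + 8 * δ / ρ * (Real.cos (ρ + δ * Real.log ρ + b)) ^ 2) * g ρ

/-- The monomial `(p cos nφ + q sin nφ) ρ^{-k} ln^i ρ` with `φ(ρ) = ρ + δ log ρ + b`. -/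
noncomputable def trigMonomial (δ b : ℝ) (n i k : ℕ) (p q ρ : ℝ) : ℝ :=
  (p * Real.cos (n * (ρ + δ * Real.log ρ + b)) + q * Real.sin (n * (ρ + δ * Real.log ρ + b))) *
    (Real.log ρ) ^ i / ρ ^ k

/-- `F` agrees on `ρ > 0` with a combination of the monomials `ρ^{-k'} ln^{i'} ρ cos n'φ` and
`ρ^{-k'} ln^{i'} ρ sin n'φ` with `k' ∈ K`, `i' ∈ I`, `n' ∈ N`. -/
def IsTrigSum (δ b : ℝ) (K I N : Finset ℕ) (F : ℝ → ℝ) : Prop :=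
  ∃ A B : ℕ → ℕ → ℕ → ℝ, ∀ ρ : ℝ, 0 < ρ →
    F ρ = ∑ k ∈ K, ∑ i ∈ I, ∑ n ∈ N, trigMonomial δ b n i k (A k i n) (B k i n) ρ

section

variable {δ b : ℝ} {K I N : Finset ℕ} {F G : ℝ → ℝ}

theorem IsTrigSum.add (hF : IsTrigSum δ b K I N F) (hG : IsTrigSum δ b K I N G) :
    IsTrigSum δ b K I N (fun ρ => F ρ + G ρ) := by
  obtain ⟨A, B, h⟩ := hF
  obtain ⟨A', B', h'⟩ := hG
  refine ⟨fun k i n => A k i n + A' k i n, fun k i n => B k i n + B' k i n, fun ρ hρ => ?_⟩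
  simp only [h ρ hρ, h' ρ hρ, ← Finset.sum_add_distrib]
  refine Finset.sum_congr rfl fun k _ => Finset.sum_congr rfl fun i _ =>
    Finset.sum_congr rfl fun n _ => ?_
  simp only [trigMonomial]
  ring

theorem IsTrigSum.const_mul (c : ℝ) (hF : IsTrigSum δ b K I N F) :
    IsTrigSum δ b K I N (fun ρ => c * F ρ) := by
  obtain ⟨A, B, h⟩ := hF
  refine ⟨fun k i n => c * A k i n, fun k i n => c * B k i n, fun ρ hρ => ?_⟩
  simp only [h ρ hρ, Finset.mul_sum]
  refine Finset.sum_congr rfl fun k _ => Finset.sum_congr rfl fun i _ =>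
    Finset.sum_congr rfl fun n _ => ?_
  simp only [trigMonomial]
  ring

theorem isTrigSum_trigMonomial {n i k : ℕ} (hk : k ∈ K) (hi : i ∈ I) (hn : n ∈ N) (p q : ℝ) :
    IsTrigSum δ b K I N (trigMonomial δ b n i k p q) := by
  refine ⟨fun k' i' n' => if k' = k ∧ i' = i ∧ n' = n then p else 0,
    fun k' i' n' => if k' = k ∧ i' = i ∧ n' = n then q else 0, fun ρ _ => ?_⟩
  rw [Finset.sum_eq_single_of_mem k hk, Finset.sum_eq_single_of_mem i hi,
    Finset.sum_eq_single_of_mem n hn]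
  · simp
  · intro n' _ h
    simp [h, trigMonomial]
  · intro i' _ h
    simp [h, trigMonomial]
  · intro k' _ h
    simp [h, trigMonomial]

end

theorem hasDerivAt_trigMonomial (δ b : ℝ) (n i k : ℕ) (p q : ℝ) {ρ : ℝ} (hρ : 0 < ρ) :
    HasDerivAt (trigMonomial δ b n i k p q)
      (trigMonomial δ b n i k (n * q) (-(n * p)) ρ
        + δ * trigMonomial δ b n i (k + 1) (n * q) (-(n * p)) ρ
        + i * trigMonomial δ b n (i - 1) (k + 1) p q ρ
        + -k * trigMonomial δ b n i (k + 1) p q ρ) ρ := by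
  have hlog := Real.hasDerivAt_log hρ.ne'
  have hφ : HasDerivAt (fun r : ℝ => n * (r + δ * Real.log r + b)) (n * (1 + δ * ρ⁻¹)) ρ :=
    (((hasDerivAt_id ρ).add (hlog.const_mul δ)).add_const b).const_mul (n : ℝ)
  have h := ((((hφ.cos.const_mul p).add (hφ.sin.const_mul q)).mul (hlog.pow i)).mul
    ((hasDerivAt_pow k ρ).inv (pow_ne_zero k hρ.ne')))
  have hpow : (k : ℝ) * ρ ^ (k - 1) = k * ρ ^ k / ρ := by
    cases k with
    | zero => simp
    | succ m => simp only [Nat.add_sub_cancel]; field_simp; ring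
  rw [hpow] at h
  refine (h.congr_deriv ?_).congr_of_eventuallyEq (Filter.Eventually.of_forall fun r => ?_)
  · simp only [trigMonomial, Pi.add_apply, Pi.mul_apply, Pi.pow_apply, Pi.inv_apply]
    field_simp
    ring
  · simp [trigMonomial, div_eq_mul_inv]

theorem deriv_deriv_trigMonomial (δ b : ℝ) (n i k : ℕ) (p q : ℝ) {ρ : ℝ} (hρ : 0 < ρ) :
    deriv (deriv (trigMonomial δ b n i k p q)) ρ =
      deriv (trigMonomial δ b n i k (n * q) (-(n * p))) ρ
        + δ * deriv (trigMonomial δ b n i (k + 1) (n * q) (-(n * p))) ρ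
        + i * deriv (trigMonomial δ b n (i - 1) (k + 1) p q) ρ
        + -k * deriv (trigMonomial δ b n i (k + 1) p q) ρ := by
  have hd (n i k : ℕ) (p q : ℝ) :=
    (hasDerivAt_trigMonomial δ b n i k p q hρ).differentiableAt.hasDerivAt
  have h : deriv (trigMonomial δ b n i k p q) =ᶠ[nhds ρ] fun r =>
      trigMonomial δ b n i k (n * q) (-(n * p)) r
        + δ * trigMonomial δ b n i (k + 1) (n * q) (-(n * p)) r
        + i * trigMonomial δ b n (i - 1) (k + 1) p q r
        + -k * trigMonomial δ b n i (k + 1) p q r := by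
    filter_upwards [lt_mem_nhds hρ] with r hr
    exact (hasDerivAt_trigMonomial δ b n i k p q hr).deriv
  rw [h.deriv_eq]
  exact ((((hd _ _ _ _ _).add ((hd _ _ _ _ _).const_mul δ)).add
    ((hd _ _ _ _ _).const_mul _)).add ((hd _ _ _ _ _).const_mul _)).deriv

theorem exists_trig_mul_cos_sq (n : ℕ) (p q : ℝ) :
    ∃ m ∈ Finset.Icc (n - 2) (n + 2), ∃ q' : ℝ, ∀ x : ℝ,
      (p * Real.cos (n * x) + q * Real.sin (n * x)) * Real.cos x ^ 2 =
        1 / 2 * (p * Real.cos (n * x) + q * Real.sin (n * x))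
          + 1 / 4 * (p * Real.cos ((n + 2 : ℕ) * x) + q * Real.sin ((n + 2 : ℕ) * x))
          + 1 / 4 * (p * Real.cos (m * x) + q' * Real.sin (m * x)) := by
  have key (x : ℝ) : (p * Real.cos (n * x) + q * Real.sin (n * x)) * Real.cos x ^ 2 =
        1 / 2 * (p * Real.cos (n * x) + q * Real.sin (n * x))
          + 1 / 4 * (p * Real.cos ((n + 2 : ℕ) * x) + q * Real.sin ((n + 2 : ℕ) * x))
          + 1 / 4 * (p * Real.cos (n * x - 2 * x) + q * Real.sin (n * x - 2 * x)) := by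
    rw [Real.cos_sq]
    push_cast
    rw [add_mul (n : ℝ) 2 x, Real.cos_add, Real.sin_add, Real.cos_sub, Real.sin_sub]
    ring
  rcases le_total 2 n with hn | hn
  · refine ⟨n - 2, Finset.mem_Icc.2 (by omega), q, fun x => ?_⟩
    rw [key, Nat.cast_sub hn, sub_mul, Nat.cast_ofNat]
  · refine ⟨2 - n, Finset.mem_Icc.2 (by omega), -q, fun x => ?_⟩
    rw [key, Nat.cast_sub hn, Nat.cast_ofNat, sub_mul, ← neg_sub (2 * x), Real.cos_neg,
      Real.sin_neg]
    ring

theorem isTrigSum_L0_trigMonomial_sub (δ b : ℝ) (n i k : ℕ) (p q : ℝ) :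
    IsTrigSum δ b (Finset.Icc (k + 1) (k + 2)) (Finset.range (i + 1)) (Finset.Icc (n - 2) (n + 2))
      (fun ρ => L0 δ b (trigMonomial δ b n i k p q) ρ
        - (1 - (n : ℝ) ^ 2) * trigMonomial δ b n i k p q ρ) := by
  obtain ⟨m, hm, q', htrig⟩ := exists_trig_mul_cos_sq n p q
  have hk1 : k + 1 ∈ Finset.Icc (k + 1) (k + 2) := by simp
  have hk2 : k + 1 + 1 ∈ Finset.Icc (k + 1) (k + 2) := by simp
  have hi0 : i ∈ Finset.range (i + 1) := by simp
  have hi1 : i - 1 ∈ Finset.range (i + 1) := Finset.mem_range.2 (by omega)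
  have hi2 : i - 1 - 1 ∈ Finset.range (i + 1) := Finset.mem_range.2 (by omega)
  have hn0 : n ∈ Finset.Icc (n - 2) (n + 2) := Finset.mem_Icc.2 (by omega)
  have hn2 : n + 2 ∈ Finset.Icc (n - 2) (n + 2) := Finset.mem_Icc.2 (by omega)
  have first {j : ℕ} (hj : j ∈ Finset.range (i + 1)) (p q : ℝ) :=
    isTrigSum_trigMonomial (δ := δ) (b := b) hk1 hj hn0 p q
  have second {j : ℕ} (hj : j ∈ Finset.range (i + 1)) (p q : ℝ) :=
    isTrigSum_trigMonomial (δ := δ) (b := b) hk2 hj hn0 p q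
  have lower {j : ℕ} (hj : j ∈ Finset.range (i + 1)) (hj' : j - 1 ∈ Finset.range (i + 1))
      (p q : ℝ) :=
    ((((first hj (n * q) (-(n * p))).add ((second hj (n * q) (-(n * p))).const_mul δ)).add
      ((second hj' p q).const_mul j)).add ((second hj p q).const_mul (-(k + 1 : ℕ))))
  have leading :=
    (((first hi0 (n * -(n * p)) (-(n * (n * q)))).const_mul δ).add
      ((first hi1 (n * q) (-(n * p))).const_mul i)).add
      ((first hi0 (n * q) (-(n * p))).const_mul (-k))
  have potential := ((second hi0 p q).const_mul (1 / 4)).add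
    ((((first hi0 p q).const_mul (1 / 2)).add
      ((isTrigSum_trigMonomial (δ := δ) (b := b) hk1 hi0 hn2 p q).const_mul (1 / 4))).add
      ((isTrigSum_trigMonomial (δ := δ) (b := b) hk1 hi0 hm p q').const_mul (1 / 4)) |>.const_mul
        (8 * δ))
  obtain ⟨A, B, hAB⟩ := (((leading.add ((lower hi0 hi1 (n * q) (-(n * p))).const_mul δ)).add
    ((lower hi1 hi2 p q).const_mul i)).add ((lower hi0 hi1 p q).const_mul (-k))).add potential
  refine ⟨A, B, fun ρ hρ => ?_⟩
  rw [← hAB ρ hρ]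
  simp only [L0, deriv_deriv_trigMonomial δ b n i k p q hρ,
    (hasDerivAt_trigMonomial δ b _ _ _ _ _ hρ).deriv]
  have hV : (1 / (4 * ρ ^ 2) + 8 * δ / ρ * Real.cos (ρ + δ * Real.log ρ + b) ^ 2) *
      trigMonomial δ b n i k p q ρ =
        1 / 4 * trigMonomial δ b n i (k + 1 + 1) p q ρ + 8 * δ *
          (1 / 2 * trigMonomial δ b n i (k + 1) p q ρ
            + 1 / 4 * trigMonomial δ b (n + 2) i (k + 1) p q ρ
            + 1 / 4 * trigMonomial δ b m i (k + 1) p q' ρ) := by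
    have h := htrig (ρ + δ * Real.log ρ + b)
    have hsplit : 8 * δ / ρ * Real.cos (ρ + δ * Real.log ρ + b) ^ 2 *
        trigMonomial δ b n i k p q ρ = 8 * δ * (((p * Real.cos (n * (ρ + δ * Real.log ρ + b))
          + q * Real.sin (n * (ρ + δ * Real.log ρ + b))) * Real.cos (ρ + δ * Real.log ρ + b) ^ 2) *
            Real.log ρ ^ i / ρ ^ (k + 1)) := by
      simp only [trigMonomial]
      field_simp
      ring
    rw [add_mul, hsplit, h]
    simp only [trigMonomial]
    field_simp
    ring
  have hlead : trigMonomial δ b n i k (n * -(n * p)) (-(n * (n * q))) ρ =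
      -(n : ℝ) ^ 2 * trigMonomial δ b n i k p q ρ := by
    simp only [trigMonomial]
    ring
  linear_combination hV + hlead

/-- Action of `L₀` on `ρ^{-k} ln^i ρ cos nφ` and `ρ^{-k} ln^i ρ sin nφ`:
the leading term is `(1−n²)ρ^{-k} ln^i ρ cos nφ` (resp. `sin`), plus terms of order
`ρ^{-(k+1)}, ρ^{-(k+2)}` with frequencies `n−2,…,n+2` and logarithms of order `≤ i`. -/
theorem L0_on_powers_cos_sin (δ b : ℝ) (hδ : 0 ≤ δ) (k n i : ℕ) (hk : 1 ≤ k) :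
    ∃ A B C D : ℕ → ℕ → ℕ → ℝ,
      (∀ ρ : ℝ, 0 < ρ →
        L0 δ b (fun r => Real.cos (n * (r + δ * Real.log r + b)) * (Real.log r) ^ i / r ^ k) ρ =
          (1 - (n : ℝ) ^ 2) *
              (Real.cos (n * (ρ + δ * Real.log ρ + b)) * (Real.log ρ) ^ i / ρ ^ k)
            + ∑ k' ∈ Finset.Icc (k + 1) (k + 2), ∑ i' ∈ Finset.range (i + 1),
                ∑ n' ∈ Finset.Icc (n - 2) (n + 2),
                  (A k' i' n' * Real.cos (n' * (ρ + δ * Real.log ρ + b))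
                    + B k' i' n' * Real.sin (n' * (ρ + δ * Real.log ρ + b))) *
                    (Real.log ρ) ^ i' / ρ ^ k') ∧
      (∀ ρ : ℝ, 0 < ρ →
        L0 δ b (fun r => Real.sin (n * (r + δ * Real.log r + b)) * (Real.log r) ^ i / r ^ k) ρ =
          (1 - (n : ℝ) ^ 2) *
              (Real.sin (n * (ρ + δ * Real.log ρ + b)) * (Real.log ρ) ^ i / ρ ^ k)
            + ∑ k' ∈ Finset.Icc (k + 1) (k + 2), ∑ i' ∈ Finset.range (i + 1),
                ∑ n' ∈ Finset.Icc (n - 2) (n + 2),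
                  (C k' i' n' * Real.cos (n' * (ρ + δ * Real.log ρ + b))
                    + D k' i' n' * Real.sin (n' * (ρ + δ * Real.log ρ + b))) *
                    (Real.log ρ) ^ i' / ρ ^ k') := by
  have expand (p q : ℝ) : ∃ A B : ℕ → ℕ → ℕ → ℝ, ∀ ρ : ℝ, 0 < ρ →
      L0 δ b (trigMonomial δ b n i k p q) ρ =
        (1 - (n : ℝ) ^ 2) * trigMonomial δ b n i k p q ρ
          + ∑ k' ∈ Finset.Icc (k + 1) (k + 2), ∑ i' ∈ Finset.range (i + 1),
              ∑ n' ∈ Finset.Icc (n - 2) (n + 2),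
                trigMonomial δ b n' i' k' (A k' i' n') (B k' i' n') ρ := by
    obtain ⟨A, B, h⟩ := isTrigSum_L0_trigMonomial_sub δ b n i k p q
    exact ⟨A, B, fun ρ hρ => by rw [← h ρ hρ]; ring⟩
  have hcos : trigMonomial δ b n i k 1 0 =
      fun r => Real.cos (n * (r + δ * Real.log r + b)) * (Real.log r) ^ i / r ^ k := by
    funext r
    simp [trigMonomial]
  have hsin : trigMonomial δ b n i k 0 1 =
      fun r => Real.sin (n * (r + δ * Real.log r + b)) * (Real.log r) ^ i / r ^ k := by
    funext r
    simp [trigMonomial]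
  obtain ⟨A, B, hAB⟩ := expand 1 0
  obtain ⟨C, D, hCD⟩ := expand 0 1
  rw [hcos] at hAB
  rw [hsin] at hCD
  exact ⟨A, B, C, D, hAB, hCD⟩
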